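/- Let c, d, n be positive integers, let x₁,…,xₙ ∈ ℝ^d be nonzero vectors with labels y₁,…,yₙ, let ℓ be a continuous nonnegative loss, B > 0, σ > 0, A > 0, r > 0, and define the function class 𝓛̂_σ(r) = {ℓ̃_σ(W,·,·) : W ∈ ℝ^{c×d}, ‖Wᵀ‖_{2,1} ≤ A, (1/n) Σ_i ℓ̃_σ(W,x_i,y_i) ≤ r}. Then the empirical Rademacher complexity satisfies R̂(𝓛̂_σ(r)) ≤ 3500·A·√(B·r·log³(35nc)) / (σ·√n). -/

import Mathlib

open MeasureTheory

/-- The quadratic ramp penalty truncated at `σ`. -/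
noncomputable def sPen (σ t : ℝ) : ℝ := if t < σ then (1 - t / σ) ^ 2 else 0

/-- `W x` as a vector in Euclidean space. -/
noncomputable def mulVecE {c d : ℕ} (W : Matrix (Fin c) (Fin d) ℝ)
    (x : EuclideanSpace ℝ (Fin d)) : EuclideanSpace ℝ (Fin c) :=
  (WithLp.equiv 2 (Fin c → ℝ)).symm (W.mulVec ((WithLp.equiv 2 (Fin d → ℝ)) x))

/-- `‖Wᵀ‖_{2,1}`: the sum of the Euclidean norms of the rows of `W`. -/
noncomputable def rowNormSum {c d : ℕ} (W : Matrix (Fin c) (Fin d) ℝ) : ℝ :=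
  ∑ i, ‖((WithLp.equiv 2 (Fin d → ℝ)).symm (W i))‖

/-- The perturbed truncated loss
`ℓ̃_σ(W,x,y) = sup_δ s_σ(‖δ‖₂) · min{B, ℓ(Wx + ‖x‖₂ δ, y)}`. -/
noncomputable def ellTilde {c d : ℕ} (ℓ : EuclideanSpace ℝ (Fin c) → Fin c → ℝ) (B σ : ℝ)
    (W : Matrix (Fin c) (Fin d) ℝ) (x : EuclideanSpace ℝ (Fin d)) (y : Fin c) : ℝ :=
  ⨆ δ : EuclideanSpace ℝ (Fin c), sPen σ ‖δ‖ * min B (ℓ (mulVecE W x + ‖x‖ • δ) y)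

/-- The law of `n` i.i.d. Rademacher (uniform `±1`) signs. -/
noncomputable def rademacherLaw (n : ℕ) : Measure (Fin n → ℝ) :=
  Measure.pi fun _ : Fin n =>
    (2 : ENNReal)⁻¹ • Measure.dirac (-1 : ℝ) + (2 : ENNReal)⁻¹ • Measure.dirac (1 : ℝ)

/-- The sign `±1` encoded by a Boolean. -/
def boolSign (b : Bool) : ℝ := if b then 1 else -1

lemma rademacherLaw_eq_sum_dirac (n : ℕ) :
    rademacherLaw n =
      ∑ e : Fin n → Bool, ((2 : ENNReal)⁻¹) ^ n • Measure.dirac fun i => boolSign (e i) := by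
  unfold rademacherLaw
  have : IsFiniteMeasure
      ((2 : ENNReal)⁻¹ • Measure.dirac (-1 : ℝ) + (2 : ENNReal)⁻¹ • Measure.dirac (1 : ℝ)) :=
    ⟨by simp⟩
  refine Measure.pi_eq fun s hs => ?_
  have hfactor : ∀ i, ((2 : ENNReal)⁻¹ • Measure.dirac (-1 : ℝ) +
      (2 : ENNReal)⁻¹ • Measure.dirac (1 : ℝ)) (s i) =
      ∑ b : Bool, (2 : ENNReal)⁻¹ * (s i).indicator 1 (boolSign b) := by
    intro i
    simp [boolSign, hs i, add_comm]
  simp_rw [hfactor]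
  rw [Finset.prod_univ_sum, Fintype.piFinset_univ]
  simp only [Measure.coe_finsetSum, Finset.sum_apply, Measure.smul_apply, smul_eq_mul]
  refine Finset.sum_congr rfl fun e _ => ?_
  rw [Measure.dirac_apply' _ (MeasurableSet.univ_pi hs), Finset.prod_mul_distrib]
  congr 1
  · simp
  · by_cases h : ∀ i, boolSign (e i) ∈ s i
    · rw [Set.indicator_of_mem (by simpa [Set.mem_univ_pi] using h)]
      simp [h]
    · rw [Set.indicator_of_notMem (by simpa [Set.mem_univ_pi] using h)]
      push Not at h
      obtain ⟨i, hi⟩ := h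
      exact (Finset.prod_eq_zero (Finset.mem_univ i) (by simp [hi])).symm

lemma integral_rademacherLaw (n : ℕ) (φ : (Fin n → ℝ) → ℝ) :
    ∫ z, φ z ∂(rademacherLaw n) =
      (∑ e : Fin n → Bool, φ fun i => boolSign (e i)) / 2 ^ n := by
  rw [rademacherLaw_eq_sum_dirac, integral_finsetSum_measure]
  · simp [integral_smul_measure, div_eq_inv_mul, Finset.mul_sum]
  · intro e _
    exact (integrable_dirac (by simp)).smul_measure (by simp)

/-- `β` bounds the average over all sign patterns of some pointwise upper bound of the
Rademacher sums indexed by `S`. -/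
def RademacherBound {n : ℕ} (S : Set (Fin n → ℝ)) (β : ℝ) : Prop :=
  ∃ M : (Fin n → Bool) → ℝ,
    (∀ e, ∀ a ∈ S, ∑ i, boolSign (e i) * a i ≤ M e) ∧ (∑ e, M e) / 2 ^ n ≤ β

lemma sum_exp_rademacher_le {n : ℕ} (a : Fin n → ℝ) (t : ℝ) :
    ∑ e : Fin n → Bool, Real.exp (t * ∑ i, boolSign (e i) * a i) ≤
      2 ^ n * Real.exp (t ^ 2 * (∑ i, a i ^ 2) / 2) := by
  have h1 : ∀ e : Fin n → Bool, Real.exp (t * ∑ i, boolSign (e i) * a i) =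
      ∏ i, Real.exp (t * (boolSign (e i) * a i)) := by
    intro e
    rw [Finset.mul_sum, Real.exp_sum]
  simp_rw [h1]
  have h2 := Finset.prod_univ_sum (fun _ : Fin n => (Finset.univ : Finset Bool))
    (fun i b => Real.exp (t * (boolSign b * a i)))
  rw [Fintype.piFinset_univ] at h2
  rw [← h2]
  have h3 : ∀ i, ∑ b : Bool, Real.exp (t * (boolSign b * a i)) = 2 * Real.cosh (t * a i) := by
    intro i
    simp [boolSign, Real.cosh_eq]
    ring
  simp_rw [h3]
  rw [Finset.prod_mul_distrib]
  have h4 : ∏ i, Real.cosh (t * a i) ≤ ∏ i, Real.exp ((t * a i) ^ 2 / 2) :=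
    Finset.prod_le_prod (fun i _ => (Real.cosh_pos _).le)
      fun i _ => Real.cosh_le_exp_half_sq _
  rw [← Real.exp_sum] at h4
  have h5 : ∑ i, (t * a i) ^ 2 / 2 = t ^ 2 * (∑ i, a i ^ 2) / 2 := by
    rw [Finset.mul_sum, Finset.sum_div]
    exact Finset.sum_congr rfl fun i _ => by ring
  rw [h5] at h4
  simpa using h4

/-- Massart's finite class lemma, for a family indexed by a finite set. -/
lemma exists_bound_rademacher_finite {n : ℕ} {ι : Type*} (S : Finset ι) (hS : S.Nonempty)
    (a : ι → Fin n → ℝ) {R Λ : ℝ} (hR : 0 < R) (hΛ : 0 < Λ)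
    (hcard : Real.log S.card ≤ Λ) (ha : ∀ s ∈ S, ∑ i, a s i ^ 2 ≤ R ^ 2) :
    ∃ M : (Fin n → Bool) → ℝ,
      (∀ e, ∀ s ∈ S, ∑ i, boolSign (e i) * a s i ≤ M e) ∧
        (∑ e, M e) / 2 ^ n ≤ R * Real.sqrt (2 * Λ) := by
  set q := Real.sqrt (2 * Λ) with hq
  have hq0 : 0 < q := Real.sqrt_pos.2 (by positivity)
  have hq2 : q ^ 2 = 2 * Λ := Real.sq_sqrt (by positivity)
  set t := q / R with ht
  have ht0 : 0 < t := by positivity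
  have htR : t * R = q := by rw [ht]; field_simp
  set K := 2 * Λ with hK
  refine ⟨fun e => (K - 1 + ∑ s ∈ S, Real.exp (t * (∑ i, boolSign (e i) * a s i) - K)) / t,
    ?_, ?_⟩
  · intro e s hs
    rw [le_div_iff₀ ht0]
    have h1 := Real.add_one_le_exp (t * (∑ i, boolSign (e i) * a s i) - K)
    have h2 := Finset.single_le_sum
      (f := fun s => Real.exp (t * (∑ i, boolSign (e i) * a s i) - K))
      (fun s _ => (Real.exp_pos _).le) hs
    linarith
  · rw [← Finset.sum_div, Finset.sum_add_distrib, Finset.sum_comm]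
    have hcard' : (S.card : ℝ) ≤ Real.exp Λ := by
      rw [← Real.log_le_iff_le_exp (by exact_mod_cast hS.card_pos)]
      exact hcard
    have h1 : ∀ s ∈ S, ∑ e : Fin n → Bool,
        Real.exp (t * (∑ i, boolSign (e i) * a s i) - K) ≤ 2 ^ n * Real.exp (-Λ) := by
      intro s hs
      simp_rw [Real.exp_sub]
      rw [← Finset.sum_div, div_le_iff₀ (Real.exp_pos _), mul_assoc, ← Real.exp_add]
      refine (sum_exp_rademacher_le (a s) t).trans ?_
      gcongr
      have := mul_le_mul_of_nonneg_left (ha s hs) (sq_nonneg t)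
      have h3 : t ^ 2 * R ^ 2 = 2 * Λ := by rw [← mul_pow, htR, hq2]
      linarith
    have h2 := Finset.sum_le_sum h1
    rw [Finset.sum_const, nsmul_eq_mul] at h2
    have h3 : (S.card : ℝ) * (2 ^ n * Real.exp (-Λ)) ≤ 2 ^ n := by
      calc (S.card : ℝ) * (2 ^ n * Real.exp (-Λ))
          ≤ Real.exp Λ * (2 ^ n * Real.exp (-Λ)) := by gcongr
        _ = 2 ^ n * (Real.exp Λ * Real.exp (-Λ)) := by ring
        _ = 2 ^ n := by rw [← Real.exp_add]; simp
    have h4 : ∑ _e : Fin n → Bool, (K - 1) = 2 ^ n * (K - 1) := by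
      rw [Finset.sum_const, nsmul_eq_mul]; simp
    rw [h4, div_div, div_le_iff₀ (by positivity)]
    have h5 : R * q * (t * 2 ^ n) = 2 ^ n * K := by
      calc R * q * (t * 2 ^ n) = (t * R) * q * 2 ^ n := by ring
        _ = 2 ^ n * K := by rw [htR, ← sq, hq2]; ring
    rw [h5]
    linarith

/-- A Dudley-type chaining bound at dyadic scales, for finite subsets. -/
lemma rademacherBound_finset_of_covers {n : ℕ} (𝒜 : Set (Fin n → ℝ)) {K Λ : ℝ}
    (hK : 0 < K) (hΛ : 0 < Λ)
    (hdiam : ∀ a ∈ 𝒜, ∀ b ∈ 𝒜, ∑ i, (a i - b i) ^ 2 ≤ K ^ 2)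
    (hcov : ∀ j : ℕ, ∃ S : Finset (Fin n → ℝ), S.Nonempty ∧ ↑S ⊆ 𝒜 ∧
      Real.log S.card ≤ 4 ^ j * Λ ∧
      ∀ a ∈ 𝒜, ∃ b ∈ S, ∑ i, (a i - b i) ^ 2 ≤ (K / 2 ^ j) ^ 2) (j : ℕ) :
    ∀ S : Finset (Fin n → ℝ), S.Nonempty → ↑S ⊆ 𝒜 → Real.log S.card ≤ 4 ^ j * Λ →
      RademacherBound (S : Set (Fin n → ℝ)) ((j + 1) * (2 * K * Real.sqrt (2 * Λ))) := by
  induction j with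
  | zero =>
    intro S hS hSA hcard
    obtain ⟨a₀, ha₀⟩ := hS
    obtain ⟨M, hM, hMβ⟩ := exists_bound_rademacher_finite S ⟨a₀, ha₀⟩
      (fun a i => a i - a₀ i) hK hΛ (by simpa using hcard)
      fun a ha => hdiam a (hSA ha) a₀ (hSA ha₀)
    refine ⟨fun e => M e + ∑ i, boolSign (e i) * a₀ i, ?_, ?_⟩
    · intro e a ha
      have := hM e a ha
      simp only [mul_sub, Finset.sum_sub_distrib] at this
      linarith
    · have hzero : ∑ e : Fin n → Bool, ∑ i, boolSign (e i) * a₀ i = 0 := by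
        have hneg := Equiv.sum_comp
          (Equiv.arrowCongr (Equiv.refl (Fin n)) Equiv.boolNot)
          (fun e : Fin n → Bool => ∑ i, boolSign (e i) * a₀ i)
        have : ∀ e : Fin n → Bool, (∑ i, boolSign
            ((Equiv.arrowCongr (Equiv.refl (Fin n)) Equiv.boolNot) e i) * a₀ i) =
            - ∑ i, boolSign (e i) * a₀ i := by
          intro e
          rw [← Finset.sum_neg_distrib]
          refine Finset.sum_congr rfl fun i _ => ?_
          cases h : e i <;> simp [boolSign, Equiv.arrowCongr, h]
        simp_rw [this] at hneg
        rw [Finset.sum_neg_distrib] at hneg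
        linarith
      rw [Finset.sum_add_distrib, hzero, add_zero]
      refine hMβ.trans ?_
      have : 0 ≤ K * Real.sqrt (2 * Λ) := by positivity
      push_cast
      linarith
  | succ j ih =>
    intro S hS hSA hcard
    obtain ⟨T, hT, hTA, hTcard, hTcov⟩ := hcov j
    choose! p hpT hp using hTcov
    obtain ⟨M₁, hM₁, hβ₁⟩ := ih T hT hTA hTcard
    obtain ⟨M₂, hM₂, hβ₂⟩ := exists_bound_rademacher_finite S hS
      (fun a i => a i - p a i) (R := K / 2 ^ j) (by positivity)
      (Λ := 4 ^ (j + 1) * Λ) (by positivity) hcard fun a ha => hp a (hSA ha)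
    refine ⟨fun e => M₁ e + M₂ e, ?_, ?_⟩
    · intro e a ha
      have h1 := hM₁ e (p a) (hpT a (hSA ha))
      have h2 := hM₂ e a ha
      simp only [mul_sub, Finset.sum_sub_distrib] at h2
      linarith
    · rw [Finset.sum_add_distrib, add_div]
      have h : Real.sqrt (2 * (4 ^ (j + 1) * Λ)) = 2 ^ (j + 1) * Real.sqrt (2 * Λ) := by
        have h4 : (2 : ℝ) * (4 ^ (j + 1) * Λ) = (2 ^ (j + 1)) ^ 2 * (2 * Λ) := by
          rw [← pow_mul, mul_comm (j + 1) 2, pow_mul]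
          norm_num
          ring
        rw [h4, Real.sqrt_mul (by positivity), Real.sqrt_sq (by positivity)]
      have h' : K / 2 ^ j * (2 ^ (j + 1) * Real.sqrt (2 * Λ)) =
          2 * K * Real.sqrt (2 * Λ) := by
        rw [pow_succ]
        field_simp
      rw [h, h'] at hβ₂
      push_cast
      linarith

/-- A Dudley-type chaining bound at dyadic scales, stopped at level `J`. -/
lemma rademacherBound_of_covers {n : ℕ} (𝒜 : Set (Fin n → ℝ)) {K Λ : ℝ}
    (hK : 0 < K) (hΛ : 0 < Λ)
    (hdiam : ∀ a ∈ 𝒜, ∀ b ∈ 𝒜, ∑ i, (a i - b i) ^ 2 ≤ K ^ 2)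
    (hcov : ∀ j : ℕ, ∃ S : Finset (Fin n → ℝ), S.Nonempty ∧ ↑S ⊆ 𝒜 ∧
      Real.log S.card ≤ 4 ^ j * Λ ∧
      ∀ a ∈ 𝒜, ∃ b ∈ S, ∑ i, (a i - b i) ^ 2 ≤ (K / 2 ^ j) ^ 2) (J : ℕ) :
    RademacherBound 𝒜
      ((J + 1) * (2 * K * Real.sqrt (2 * Λ)) + Real.sqrt n * (K / 2 ^ J)) := by
  obtain ⟨S, hS, hSA, hcard, hScov⟩ := hcov J
  obtain ⟨M, hM, hβ⟩ :=
    rademacherBound_finset_of_covers 𝒜 hK hΛ hdiam hcov J S hS hSA hcard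
  refine ⟨fun e => M e + Real.sqrt n * (K / 2 ^ J), ?_, ?_⟩
  · intro e a ha
    obtain ⟨b, hb, hab⟩ := hScov a ha
    have h1 := hM e b hb
    have h2 := Real.sum_mul_le_sqrt_mul_sqrt Finset.univ (fun i => boolSign (e i))
      fun i => a i - b i
    have h3 : ∑ i, boolSign (e i) ^ 2 = n := by
      have : ∀ b, boolSign b ^ 2 = 1 := by intro b; cases b <;> simp [boolSign]
      simp [this]
    rw [h3] at h2
    have h4 : Real.sqrt (∑ i, (a i - b i) ^ 2) ≤ K / 2 ^ J :=
      (Real.sqrt_le_left (by positivity)).2 hab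
    have h5 := mul_le_mul_of_nonneg_left h4 (Real.sqrt_nonneg (n : ℝ))
    simp only [mul_sub, Finset.sum_sub_distrib] at h2
    linarith
  · rw [Finset.sum_add_distrib, add_div]
    have hconst : (∑ _e : Fin n → Bool, Real.sqrt n * (K / 2 ^ J)) / 2 ^ n =
        Real.sqrt n * (K / 2 ^ J) := by
      rw [Finset.sum_const, nsmul_eq_mul]; simp
    rw [hconst]
    linarith

lemma sPen_eq_sq {σ : ℝ} (hσ : 0 < σ) (t : ℝ) : sPen σ t = (max 0 (1 - t / σ)) ^ 2 := by
  unfold sPen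
  split_ifs with h
  · rw [max_eq_right]
    have := (div_lt_one hσ).2 h
    linarith
  · rw [max_eq_left]
    · simp
    · have := (one_le_div hσ).2 (not_lt.1 h)
      linarith

lemma sPen_nonneg {σ : ℝ} (hσ : 0 < σ) (t : ℝ) : 0 ≤ sPen σ t := by
  rw [sPen_eq_sq hσ]; positivity

lemma sPen_le_one {σ : ℝ} (hσ : 0 < σ) {t : ℝ} (ht : 0 ≤ t) : sPen σ t ≤ 1 := by
  rw [sPen_eq_sq hσ]
  have h : 0 ≤ t / σ := by positivity
  exact pow_le_one₀ (le_max_left _ _) (max_le zero_le_one (by linarith))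

section SmoothedSup

variable {E : Type*} [NormedAddCommGroup E] {G : E → ℝ} {B σ : ℝ}

lemma bddAbove_sPen_mul (hσ : 0 < σ) (hG0 : ∀ q, 0 ≤ G q) (hGB : ∀ q, G q ≤ B) (p : E) :
    BddAbove (Set.range fun δ : E => sPen σ ‖δ‖ * G (p + δ)) := by
  refine ⟨B, ?_⟩
  rintro _ ⟨δ, rfl⟩
  have h1 := sPen_le_one hσ (norm_nonneg δ)
  have h2 := sPen_nonneg hσ ‖δ‖
  have h3 := hG0 (p + δ)
  have h4 := hGB (p + δ)
  simp only
  nlinarith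

lemma iSup_sPen_mul_nonneg (hσ : 0 < σ) (hG0 : ∀ q, 0 ≤ G q) (p : E) :
    0 ≤ ⨆ δ : E, sPen σ ‖δ‖ * G (p + δ) :=
  Real.iSup_nonneg fun _ => mul_nonneg (sPen_nonneg hσ _) (hG0 _)

/-- The square root of the smoothed supremum is Lipschitz. -/
lemma sqrt_iSup_sPen_mul_le (hσ : 0 < σ) (hG0 : ∀ q, 0 ≤ G q) (hGB : ∀ q, G q ≤ B)
    (p p' : E) :
    Real.sqrt (⨆ δ : E, sPen σ ‖δ‖ * G (p + δ)) ≤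
      Real.sqrt (⨆ δ : E, sPen σ ‖δ‖ * G (p' + δ)) + Real.sqrt B / σ * ‖p - p'‖ := by
  set f' := ⨆ δ : E, sPen σ ‖δ‖ * G (p' + δ)
  rw [Real.sqrt_le_left (by positivity)]
  refine ciSup_le fun δ => ?_
  set δ' := δ + (p - p') with hδ'
  have hpt : p + δ = p' + δ' := by rw [hδ']; abel
  have h1 : sPen σ ‖δ'‖ * G (p' + δ') ≤ f' :=
    le_ciSup (bddAbove_sPen_mul hσ hG0 hGB p') δ'
  rw [hpt, sPen_eq_sq hσ]
  rw [sPen_eq_sq hσ] at h1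
  set g := Real.sqrt (G (p' + δ')) with hg
  have hg2 : G (p' + δ') = g ^ 2 := (Real.sq_sqrt (hG0 _)).symm
  have hgB : g ≤ Real.sqrt B := Real.sqrt_le_sqrt (hGB _)
  have hg0 : 0 ≤ g := Real.sqrt_nonneg _
  rw [hg2, ← mul_pow] at h1 ⊢
  have h2 : max 0 (1 - ‖δ'‖ / σ) * g ≤ Real.sqrt f' := Real.le_sqrt_of_sq_le h1
  have h3 : ‖δ'‖ ≤ ‖δ‖ + ‖p - p'‖ := norm_add_le _ _
  have h4 : max 0 (1 - ‖δ‖ / σ) ≤ max 0 (1 - ‖δ'‖ / σ) + ‖p - p'‖ / σ := by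
    have h5 : ‖δ'‖ / σ ≤ ‖δ‖ / σ + ‖p - p'‖ / σ := by
      rw [← add_div]; gcongr
    have h6 : 0 ≤ ‖p - p'‖ / σ := by positivity
    refine max_le (add_nonneg (le_max_left _ _) h6) ?_
    linarith [le_max_right 0 (1 - ‖δ'‖ / σ)]
  have h7 : max 0 (1 - ‖δ‖ / σ) * g ≤
      max 0 (1 - ‖δ'‖ / σ) * g + Real.sqrt B / σ * ‖p - p'‖ := by
    calc max 0 (1 - ‖δ‖ / σ) * g ≤ (max 0 (1 - ‖δ'‖ / σ) + ‖p - p'‖ / σ) * g := by gcongr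
      _ = max 0 (1 - ‖δ'‖ / σ) * g + ‖p - p'‖ / σ * g := by ring
      _ ≤ max 0 (1 - ‖δ'‖ / σ) * g + ‖p - p'‖ / σ * Real.sqrt B := by gcongr
      _ = _ := by ring
  exact pow_le_pow_left₀ (by positivity) (h7.trans (by linarith)) 2

lemma sq_iSup_sPen_mul_sub_le (hσ : 0 < σ) (hB : 0 ≤ B) (hG0 : ∀ q, 0 ≤ G q)
    (hGB : ∀ q, G q ≤ B) (p p' : E) {h : ℝ} (hpp : ‖p - p'‖ ≤ h) :
    ((⨆ δ : E, sPen σ ‖δ‖ * G (p + δ)) - ⨆ δ : E, sPen σ ‖δ‖ * G (p' + δ)) ^ 2 ≤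
      2 * B * h ^ 2 / σ ^ 2 *
        ((⨆ δ : E, sPen σ ‖δ‖ * G (p + δ)) + ⨆ δ : E, sPen σ ‖δ‖ * G (p' + δ)) := by
  have h1 := sqrt_iSup_sPen_mul_le hσ hG0 hGB p p'
  have h2 := sqrt_iSup_sPen_mul_le hσ hG0 hGB p' p
  rw [norm_sub_rev] at h2
  have hf := iSup_sPen_mul_nonneg hσ hG0 p
  have hf' := iSup_sPen_mul_nonneg hσ hG0 p'
  set f := ⨆ δ : E, sPen σ ‖δ‖ * G (p + δ)
  set f' := ⨆ δ : E, sPen σ ‖δ‖ * G (p' + δ)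
  set g := Real.sqrt f
  set g' := Real.sqrt f'
  have hg : f = g ^ 2 := (Real.sq_sqrt hf).symm
  have hg' : f' = g' ^ 2 := (Real.sq_sqrt hf').symm
  have h3 : Real.sqrt B / σ * ‖p - p'‖ ≤ Real.sqrt B / σ * h := by gcongr
  have h4 : (g - g') ^ 2 ≤ (Real.sqrt B / σ * h) ^ 2 := by
    exact sq_le_sq' (by linarith) (by linarith)
  have h5 : (Real.sqrt B / σ * h) ^ 2 = B * h ^ 2 / σ ^ 2 := by
    rw [mul_pow, div_pow, Real.sq_sqrt hB]; ring
  rw [h5] at h4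
  have h6 : 0 ≤ B * h ^ 2 / σ ^ 2 := by positivity
  rw [hg, hg']
  calc (g ^ 2 - g' ^ 2) ^ 2 = (g - g') ^ 2 * (g + g') ^ 2 := by ring
    _ ≤ (B * h ^ 2 / σ ^ 2) * (2 * (g ^ 2 + g' ^ 2)) := by
      gcongr
      nlinarith [sq_nonneg (g - g')]
    _ = _ := by ring

end SmoothedSup

section RowCover

variable {E : Type*} [NormedAddCommGroup E] [InnerProductSpace ℝ E] {n c : ℕ}

/-- A signed element of the family `u`, or zero. -/
def signedAtom (u : Fin n → E) : Option (Fin n × Bool) → E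
  | none => 0
  | some (i, b) => boolSign b • u i

/-- Matching pursuit: a vector is approximated, uniformly over a family of vectors of norm at
most one, by a short signed sum of members of the family. -/
lemma exists_signedAtom_approx (u : Fin n → E) (hu : ∀ i, ‖u i‖ ≤ 1) {ε : ℝ} (hε : 0 ≤ ε)
    (N : ℕ) : ∀ w : E, ‖w‖ ^ 2 ≤ N * ε ^ 2 →
      ∃ s : Fin N → Option (Fin n × Bool),
        ∀ i, |inner ℝ (w - ε • ∑ j, signedAtom u (s j)) (u i)| ≤ ε := by
  induction N with
  | zero =>
    intro w hw
    have hw0 : w = 0 := by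
      have : ‖w‖ ^ 2 ≤ 0 := by simpa using hw
      simpa using le_antisymm this (sq_nonneg _)
    exact ⟨Fin.elim0, fun i => by simpa [hw0] using hε⟩
  | succ N ih =>
    intro w hw
    by_cases h : ∀ i, |inner ℝ w (u i)| ≤ ε
    · exact ⟨fun _ => none, fun i => by simpa [signedAtom] using h i⟩
    · push Not at h
      obtain ⟨i, hi⟩ := h
      obtain ⟨b, hb⟩ : ∃ b, boolSign b * inner ℝ w (u i) = |inner ℝ w (u i)| := by
        rcases abs_choice (inner ℝ w (u i)) with h | h
        · exact ⟨true, by rw [h]; simp [boolSign]⟩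
        · exact ⟨false, by rw [h]; simp [boolSign]⟩
      have hb2 : boolSign b ^ 2 = 1 := by cases b <;> simp [boolSign]
      have hstep : ‖w - ε • signedAtom u (some (i, b))‖ ^ 2 ≤ N * ε ^ 2 := by
        rw [norm_sub_sq_real]
        simp only [signedAtom, inner_smul_right, norm_smul, mul_pow, Real.norm_eq_abs, sq_abs]
        rw [hb, hb2, one_mul]
        have h1 : ‖u i‖ ^ 2 ≤ 1 := pow_le_one₀ (norm_nonneg _) (hu i)
        have h2 := mul_le_mul_of_nonneg_left h1 (sq_nonneg ε)
        have h3 := mul_le_mul_of_nonneg_left hi.le hε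
        push_cast at hw
        nlinarith
      obtain ⟨s, hs⟩ := ih _ hstep
      refine ⟨Fin.cons (some (i, b)) s, fun k => ?_⟩
      have := hs k
      rw [Fin.sum_univ_succ]
      simpa [smul_add, sub_sub] using this

/-- The slots of a code that carry the label `k`, counted. -/
noncomputable def slotCount (k : Fin c) : Option (Fin c × Option (Fin n × Bool)) → ℝ
  | none => 0
  | some (k', _) => if k' = k then 1 else 0

/-- The atom a slot contributes to row `k`. -/
noncomputable def slotAtom (u : Fin n → E) (k : Fin c) :
    Option (Fin c × Option (Fin n × Bool)) → E
  | none => 0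
  | some (k', b) => if k' = k then signedAtom u b else 0

/-- The family of rows described by a code of length `m`. -/
noncomputable def decodeRows (u : Fin n → E) (A : ℝ) (m : ℕ)
    (s : Fin m → Option (Fin c × Option (Fin n × Bool))) (k : Fin c) : E :=
  (2 * A * Real.sqrt (∑ j, slotCount k (s j)) / m) • ∑ j, slotAtom u k (s j)

lemma sum_extend_none {ι κ β M : Type*} [Fintype ι] [Fintype κ] [AddCommMonoid M] {e : ι → κ}
    (he : Function.Injective e) (g : ι → β) (H : Option β → M) (h0 : H none = 0) :
    ∑ j, H (Function.extend e (fun p => some (g p)) (fun _ => none) j) =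
      ∑ p, H (some (g p)) := by
  classical
  symm
  refine Finset.sum_of_injOn e he.injOn (by simp) ?_ ?_
  · intro j _ hj
    rw [Function.extend_apply' _ _ _ (by simpa using hj), h0]
  · intro p _
    rw [he.extend_apply]

lemma exists_decodeRows_approx (u : Fin n → E) (hu : ∀ i, ‖u i‖ ≤ 1) {A : ℝ} (hA : 0 < A)
    {m : ℕ} (hm : 0 < m) (w : Fin c → E) (hw : ∑ k, ‖w k‖ ≤ A) :
    ∃ s : Fin m → Option (Fin c × Option (Fin n × Bool)),
      ∀ i, ∑ k, (inner ℝ (w k - decodeRows u A m s k) (u i)) ^ 2 ≤ 4 * A ^ 2 / m := by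
  have hm' : (0 : ℝ) < m := by exact_mod_cast hm
  set q : Fin c → ℕ := fun k => ⌊m * ‖w k‖ / A⌋₊ with hq
  have hq_le : ∀ k, (q k : ℝ) ≤ m * ‖w k‖ / A := fun k => Nat.floor_le (by positivity)
  have hq_lt : ∀ k, m * ‖w k‖ / A < q k + 1 := fun k => Nat.lt_floor_add_one _
  have hsum : ∑ k, q k ≤ m := by
    have h : ((∑ k, q k : ℕ) : ℝ) ≤ m := by
      push_cast
      calc ∑ k, (q k : ℝ) ≤ ∑ k, m * ‖w k‖ / A := Finset.sum_le_sum fun k _ => hq_le k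
        _ = m * (∑ k, ‖w k‖) / A := by rw [Finset.mul_sum, Finset.sum_div]
        _ ≤ m * A / A := by gcongr
        _ = m := by field_simp
    exact_mod_cast h
  set ε : Fin c → ℝ := fun k => 2 * A * Real.sqrt (q k) / m with hε
  have hrow : ∀ k, ∃ s : Fin (q k) → Option (Fin n × Bool), ∀ i,
      (inner ℝ (w k - ε k • ∑ j, signedAtom u (s j)) (u i)) ^ 2 ≤ 4 * A * ‖w k‖ / m := by
    intro k
    rcases Nat.eq_zero_or_pos (q k) with h0 | hpos
    · refine ⟨fun _ => none, fun i => ?_⟩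
      have h1 : m * ‖w k‖ < A := by
        have := hq_lt k
        rw [h0, div_lt_iff₀ hA] at this
        simpa using this
      have h2 : |inner ℝ (w k) (u i)| ≤ ‖w k‖ :=
        (abs_real_inner_le_norm _ _).trans
          (mul_le_of_le_one_right (norm_nonneg _) (hu i))
      have h3 : (inner ℝ (w k) (u i)) ^ 2 ≤ ‖w k‖ ^ 2 :=
        sq_le_sq.2 (by rwa [abs_of_nonneg (norm_nonneg (w k))])
      simp only [signedAtom, Finset.sum_const_zero, smul_zero, sub_zero]
      refine h3.trans ?_
      rw [le_div_iff₀ hm']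
      nlinarith [norm_nonneg (w k)]
    · have hq1 : (1 : ℝ) ≤ q k := by exact_mod_cast hpos
      have hsq : Real.sqrt (q k) ^ 2 = q k := Real.sq_sqrt (by positivity)
      have hε2 : ε k ^ 2 = 4 * A ^ 2 * q k / m ^ 2 := by
        simp only [hε]
        rw [div_pow, mul_pow, hsq]
        ring
      have hwk : ‖w k‖ ≤ 2 * A * q k / m := by
        have := hq_lt k
        rw [div_lt_iff₀ hA] at this
        rw [le_div_iff₀ hm']
        nlinarith
      obtain ⟨s, hs⟩ := exists_signedAtom_approx u hu (ε := ε k) (by positivity) (q k) (w k) (by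
        rw [hε2]
        calc ‖w k‖ ^ 2 ≤ (2 * A * q k / m) ^ 2 := by gcongr
          _ = _ := by ring)
      refine ⟨s, fun i => ?_⟩
      have h1 : (inner ℝ (w k - ε k • ∑ j, signedAtom u (s j)) (u i)) ^ 2 ≤ ε k ^ 2 :=
        sq_le_sq.2 ((hs i).trans (le_abs_self _))
      refine h1.trans ?_
      rw [hε2]
      calc 4 * A ^ 2 * q k / m ^ 2 ≤ 4 * A ^ 2 * (m * ‖w k‖ / A) / m ^ 2 := by
            gcongr
            exact hq_le k
        _ = _ := by field_simp
  choose s hs using hrow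
  obtain ⟨e⟩ : Nonempty ((Σ k, Fin (q k)) ↪ Fin m) :=
    Function.Embedding.nonempty_of_card_le (by simpa using hsum)
  set code : Fin m → Option (Fin c × Option (Fin n × Bool)) :=
    Function.extend e (fun p => some (p.1, s p.1 p.2)) (fun _ => none) with hcode
  have hcount : ∀ k, ∑ j, slotCount k (code j) = q k := by
    intro k
    rw [hcode, sum_extend_none e.injective (fun p => (p.1, s p.1 p.2)) (slotCount k) rfl,
      Fintype.sum_sigma, Finset.sum_eq_single k]
    · simp [slotCount]
    · intro k' _ hk'
      simp [slotCount, hk']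
    · simp
  have hatom : ∀ k, ∑ j, slotAtom u k (code j) = ∑ j, signedAtom u (s k j) := by
    intro k
    rw [hcode, sum_extend_none e.injective (fun p => (p.1, s p.1 p.2)) (slotAtom u k) rfl,
      Fintype.sum_sigma, Finset.sum_eq_single k]
    · simp [slotAtom]
    · intro k' _ hk'
      simp [slotAtom, hk']
    · simp
  refine ⟨code, fun i => ?_⟩
  calc ∑ k, (inner ℝ (w k - decodeRows u A m code k) (u i)) ^ 2
      ≤ ∑ k, 4 * A * ‖w k‖ / m := by
        refine Finset.sum_le_sum fun k _ => ?_
        unfold decodeRows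
        rw [hcount, hatom]
        exact hs k i
    _ = 4 * A * (∑ k, ‖w k‖) / m := by rw [Finset.mul_sum, Finset.sum_div]
    _ ≤ 4 * A * A / m := by gcongr
    _ = _ := by ring

end RowCover

section LossClass

variable {c d n : ℕ}

/-- The inner products of the rows `V` with `u`, as a Euclidean vector. -/
noncomputable def rowInner {E : Type*} [NormedAddCommGroup E] [InnerProductSpace ℝ E]
    (V : Fin c → E) (u : E) : EuclideanSpace ℝ (Fin c) :=
  WithLp.toLp 2 fun k => inner ℝ (V k) u

lemma norm_rowInner_sub_sq {E : Type*} [NormedAddCommGroup E] [InnerProductSpace ℝ E]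
    (V V' : Fin c → E) (u : E) :
    ‖rowInner V u - rowInner V' u‖ ^ 2 = ∑ k, (inner ℝ (V k - V' k) u) ^ 2 := by
  simp [EuclideanSpace.norm_sq_eq, rowInner, inner_sub_left]

lemma norm_rowInner_le {E : Type*} [NormedAddCommGroup E] [InnerProductSpace ℝ E]
    (V : Fin c → E) {u : E} (hu : ‖u‖ ≤ 1) {A : ℝ} (hV : ∑ k, ‖V k‖ ≤ A) :
    ‖rowInner V u‖ ≤ A := by
  have hA : 0 ≤ A := (Finset.sum_nonneg fun k _ => norm_nonneg (V k)).trans hV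
  refine le_of_sq_le_sq ?_ hA
  have h1 : ‖rowInner V u‖ ^ 2 = ∑ k, (inner ℝ (V k) u) ^ 2 := by
    simp [EuclideanSpace.norm_sq_eq, rowInner]
  rw [h1]
  calc ∑ k, (inner ℝ (V k) u) ^ 2 ≤ ∑ k, ‖V k‖ * A := by
        refine Finset.sum_le_sum fun k _ => ?_
        have h2 : |inner ℝ (V k) u| ≤ ‖V k‖ :=
          (abs_real_inner_le_norm _ _).trans (mul_le_of_le_one_right (norm_nonneg _) hu)
        have h3 : ‖V k‖ ≤ A :=
          (Finset.single_le_sum (f := fun k => ‖V k‖) (fun k _ => norm_nonneg (V k))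
            (Finset.mem_univ k)).trans hV
        rw [← sq_abs, sq]
        exact mul_le_mul h2 (h2.trans h3) (abs_nonneg _) (norm_nonneg _)
    _ = (∑ k, ‖V k‖) * A := by rw [Finset.sum_mul]
    _ ≤ A ^ 2 := by rw [sq]; gcongr

/-- The rows of a matrix as Euclidean vectors. -/
noncomputable def matrixRows (W : Matrix (Fin c) (Fin d) ℝ) (k : Fin c) :
    EuclideanSpace ℝ (Fin d) :=
  (WithLp.equiv 2 (Fin d → ℝ)).symm (W k)

lemma mulVecE_eq_smul_rowInner (W : Matrix (Fin c) (Fin d) ℝ) (x : EuclideanSpace ℝ (Fin d)) :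
    mulVecE W x = ‖x‖ • rowInner (matrixRows W) (‖x‖⁻¹ • x) := by
  ext k
  rcases eq_or_ne x 0 with rfl | hx
  · simp [mulVecE]
  · have hx' : ‖x‖ ≠ 0 := norm_ne_zero_iff.2 hx
    simp only [mulVecE, rowInner, matrixRows, inner_smul_right, PiLp.inner_apply,
      PiLp.smul_apply, smul_eq_mul, mul_inv_cancel_left₀ hx']
    simp [Matrix.mulVec, dotProduct, mul_comm]

lemma ellTilde_eq_iSup (ℓ : EuclideanSpace ℝ (Fin c) → Fin c → ℝ) (B σ : ℝ)
    (W : Matrix (Fin c) (Fin d) ℝ) (x : EuclideanSpace ℝ (Fin d)) (y : Fin c) :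
    ellTilde ℓ B σ W x y = ⨆ δ : EuclideanSpace ℝ (Fin c), sPen σ ‖δ‖ *
      (fun q => min B (ℓ (‖x‖ • q) y)) (rowInner (matrixRows W) (‖x‖⁻¹ • x) + δ) := by
  simp only [ellTilde, mulVecE_eq_smul_rowInner, smul_add]

/-- On the localized class, the empirical distance of losses is controlled by the uniform
distance of the predictions. -/
lemma sum_sq_ellTilde_sub_le (hn : 0 < n) (x : Fin n → EuclideanSpace ℝ (Fin d))
    (y : Fin n → Fin c) (ℓ : EuclideanSpace ℝ (Fin c) → Fin c → ℝ)
    (hnonneg : ∀ v yy, 0 ≤ ℓ v yy) {B σ r h : ℝ} (hB : 0 < B) (hσ : 0 < σ)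
    {W W' : Matrix (Fin c) (Fin d) ℝ}
    (hW : (1 / n : ℝ) * ∑ i, ellTilde ℓ B σ W (x i) (y i) ≤ r)
    (hW' : (1 / n : ℝ) * ∑ i, ellTilde ℓ B σ W' (x i) (y i) ≤ r)
    (hdist : ∀ i, ‖rowInner (matrixRows W) (‖x i‖⁻¹ • x i) -
      rowInner (matrixRows W') (‖x i‖⁻¹ • x i)‖ ≤ h) :
    ∑ i, (ellTilde ℓ B σ W (x i) (y i) - ellTilde ℓ B σ W' (x i) (y i)) ^ 2 ≤
      4 * n * r * B * h ^ 2 / σ ^ 2 := by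
  have hn' : (0 : ℝ) < n := by exact_mod_cast hn
  rw [one_div_mul_eq_div, div_le_iff₀ hn'] at hW hW'
  calc ∑ i, (ellTilde ℓ B σ W (x i) (y i) - ellTilde ℓ B σ W' (x i) (y i)) ^ 2
      ≤ ∑ i, 2 * B * h ^ 2 / σ ^ 2 *
          (ellTilde ℓ B σ W (x i) (y i) + ellTilde ℓ B σ W' (x i) (y i)) := by
        refine Finset.sum_le_sum fun i _ => ?_
        rw [ellTilde_eq_iSup, ellTilde_eq_iSup]
        exact sq_iSup_sPen_mul_sub_le hσ hB.le (fun q => le_min hB.le (hnonneg _ _))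
          (fun q => min_le_left _ _) _ _ (hdist i)
    _ = 2 * B * h ^ 2 / σ ^ 2 * (∑ i, ellTilde ℓ B σ W (x i) (y i) +
          ∑ i, ellTilde ℓ B σ W' (x i) (y i)) := by
        rw [← Finset.mul_sum, Finset.sum_add_distrib]
    _ ≤ 2 * B * h ^ 2 / σ ^ 2 * (r * n + r * n) := by gcongr
    _ = _ := by ring

/-- An external cover indexed by a finite type yields an internal one of twice the radius. -/
lemma exists_internal_cover {X C : Type*} [Fintype C] {F : Set X} (hF : F.Nonempty)
    (near : X → C → Prop) (hnear : ∀ a ∈ F, ∃ s, near a s) :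
    ∃ S : Finset X, S.Nonempty ∧ ↑S ⊆ F ∧ S.card ≤ Fintype.card C ∧
      ∀ a ∈ F, ∃ b ∈ S, ∃ s, near a s ∧ near b s := by
  classical
  obtain ⟨a₀, ha₀⟩ := hF
  have hpick : ∀ s, ∃ b ∈ F, (∃ a ∈ F, near a s) → near b s := by
    intro s
    by_cases h : ∃ a ∈ F, near a s
    · obtain ⟨a, ha, has⟩ := h
      exact ⟨a, ha, fun _ => has⟩
    · exact ⟨a₀, ha₀, fun h' => absurd h' h⟩
  choose p hpF hp using hpick
  obtain ⟨s₀, -⟩ := hnear a₀ ha₀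
  refine ⟨Finset.univ.image p, ⟨p s₀, by simp⟩, ?_, Finset.card_image_le, ?_⟩
  · simpa [Set.subset_def] using hpF
  · intro a ha
    obtain ⟨s, hs⟩ := hnear a ha
    exact ⟨p s, by simp, s, hs, hp s ⟨a, ha, hs⟩⟩

lemma exists_matrix_cover (hn : 0 < n) (hc : 0 < c)
    (u : Fin n → EuclideanSpace ℝ (Fin d)) (hu : ∀ i, ‖u i‖ ≤ 1)
    {A : ℝ} (hA : 0 < A) {F : Set (Matrix (Fin c) (Fin d) ℝ)} (hF : F.Nonempty)
    (hFA : ∀ W ∈ F, rowNormSum W ≤ A) (j : ℕ) :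
    ∃ S : Finset (Matrix (Fin c) (Fin d) ℝ), S.Nonempty ∧ ↑S ⊆ F ∧
      Real.log S.card ≤ 4 ^ j * Real.log (35 * n * c) ∧
      ∀ W ∈ F, ∃ W' ∈ S, ∀ i,
        ‖rowInner (matrixRows W) (u i) - rowInner (matrixRows W') (u i)‖ ≤ 4 * A / 2 ^ j := by
  obtain ⟨S, hS, hSF, hcard, hcov⟩ := exists_internal_cover
    (C := Fin (4 ^ j) → Option (Fin c × Option (Fin n × Bool))) hF
    (fun W s => ∀ i, ‖rowInner (matrixRows W) (u i) -
      rowInner (decodeRows u A (4 ^ j) s) (u i)‖ ≤ 2 * A / 2 ^ j) (by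
    intro W hW
    obtain ⟨s, hs⟩ := exists_decodeRows_approx u hu hA (m := 4 ^ j) (by positivity)
      (matrixRows W) (hFA W hW)
    refine ⟨s, fun i => le_of_sq_le_sq ?_ (by positivity)⟩
    rw [norm_rowInner_sub_sq]
    refine (hs i).trans_eq ?_
    rw [div_pow, ← pow_mul, mul_comm j 2, pow_mul]
    push_cast
    ring)
  refine ⟨S, hS, hSF, ?_, ?_⟩
  · have hnat : Fintype.card (Option (Fin c × Option (Fin n × Bool))) ≤ 35 * n * c := by
      simp
      nlinarith [Nat.mul_le_mul hn hc, Nat.mul_le_mul_right c hn]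
    have h1 : (S.card : ℝ) ≤ (35 * n * c) ^ (4 ^ j) := by
      have h2 : S.card ≤ (35 * n * c) ^ (4 ^ j) := by
        refine hcard.trans ?_
        rw [Fintype.card_fun, Fintype.card_fin]
        exact Nat.pow_le_pow_left hnat _
      exact_mod_cast h2
    have h3 := Real.log_le_log (by exact_mod_cast hS.card_pos) h1
    rw [Real.log_pow] at h3
    exact_mod_cast h3
  · intro W hW
    obtain ⟨W', hW', s, h1, h2⟩ := hcov W hW
    refine ⟨W', hW', fun i => ?_⟩
    have h3 := norm_sub_le_norm_sub_add_norm_sub (rowInner (matrixRows W) (u i))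
      (rowInner (decodeRows u A (4 ^ j) s) (u i)) (rowInner (matrixRows W') (u i))
    rw [norm_sub_rev (rowInner (decodeRows u A (4 ^ j) s) (u i))] at h3
    have h4 : 4 * A / 2 ^ j = 2 * A / 2 ^ j + 2 * A / 2 ^ j := by ring
    linarith [h1 i, h2 i]

end LossClass

lemma three_le_log_of_pos {n c : ℕ} (hn : 0 < n) (hc : 0 < c) :
    3 ≤ Real.log (35 * n * c) := by
  have hn' : (1 : ℝ) ≤ n := by exact_mod_cast hn
  have hc' : (1 : ℝ) ≤ c := by exact_mod_cast hc
  rw [Real.le_log_iff_exp_le (by positivity)]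
  have h1 : Real.exp 3 = Real.exp 1 ^ 3 := by rw [← Real.exp_nat_mul]; norm_num
  have h2 := Real.exp_one_lt_d9
  have h3 : Real.exp 1 ^ 3 ≤ 3 ^ 3 :=
    pow_le_pow_left₀ (Real.exp_pos _).le (by linarith) 3
  have h4 : (35 : ℝ) * 1 * 1 ≤ 35 * n * c := by gcongr
  linarith

lemma natLog_add_two_le {n c : ℕ} (hn : 0 < n) (hc : 0 < c) :
    (Nat.log 2 n : ℝ) + 2 ≤ 2 * Real.log (35 * n * c) := by
  have hn' : (0 : ℝ) < n := by exact_mod_cast hn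
  have hc' : (1 : ℝ) ≤ c := by exact_mod_cast hc
  have h1 : (2 : ℝ) ^ (Nat.log 2 n + 2) ≤ 35 * n * c := by
    have h2 : (2 : ℝ) ^ Nat.log 2 n ≤ n := by exact_mod_cast Nat.pow_log_le_self 2 hn.ne'
    have h3 : (35 : ℝ) * n * 1 ≤ 35 * n * c := by gcongr
    rw [pow_add]
    linarith
  have h4 := Real.log_le_log (by positivity) h1
  rw [Real.log_pow] at h4
  push_cast at h4
  have h5 := Real.log_two_gt_d9
  have h6 : (0 : ℝ) ≤ Nat.log 2 n := by positivity
  nlinarith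

/-- Empirical Rademacher complexity bound for the class
`𝓛̂_σ(r) = {ℓ̃_σ(W,·,·) : ‖Wᵀ‖_{2,1} ≤ A, (1/n)∑ᵢ ℓ̃_σ(W,xᵢ,yᵢ) ≤ r}`:
`R̂(𝓛̂_σ(r)) ≤ 3500 A √(B r log³(35nc)) / (σ√n)`. -/
theorem loss_class_rademacher_bound (c d n : ℕ) (hc : 0 < c) (hd : 0 < d) (hn : 0 < n)
    (x : Fin n → EuclideanSpace ℝ (Fin d)) (hx : ∀ i, x i ≠ 0) (y : Fin n → Fin c)
    (ℓ : EuclideanSpace ℝ (Fin c) → Fin c → ℝ)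
    (hcont : Continuous fun vy : EuclideanSpace ℝ (Fin c) × Fin c => ℓ vy.1 vy.2)
    (hnonneg : ∀ v yy, 0 ≤ ℓ v yy)
    (B σ A r : ℝ) (hB : 0 < B) (hσ : 0 < σ) (hA : 0 < A) (hr : 0 < r) :
    (∫ z : Fin n → ℝ,
        sSup {v : ℝ | ∃ W : Matrix (Fin c) (Fin d) ℝ,
          rowNormSum W ≤ A ∧ (1 / n : ℝ) * ∑ i, ellTilde ℓ B σ W (x i) (y i) ≤ r ∧
          v = (1 / n : ℝ) * ∑ i, z i * ellTilde ℓ B σ W (x i) (y i)}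
        ∂(rademacherLaw n)) ≤
      3500 * A * Real.sqrt (B * r * (Real.log (35 * n * c)) ^ 3) / (σ * Real.sqrt n) := by
  have hn' : (0 : ℝ) < n := by exact_mod_cast hn
  set Λ := Real.log (35 * n * c) with hΛ
  have hΛ3 : 3 ≤ Λ := three_le_log_of_pos hn hc
  set F : Set (Matrix (Fin c) (Fin d) ℝ) := {W | rowNormSum W ≤ A ∧
    (1 / n : ℝ) * ∑ i, ellTilde ℓ B σ W (x i) (y i) ≤ r}
  have hrhs : 0 ≤ 3500 * A * Real.sqrt (B * r * Λ ^ 3) / (σ * Real.sqrt n) := by positivity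
  rw [integral_rademacherLaw]
  rcases F.eq_empty_or_nonempty with hF | hF
  · have hempty : ∀ z : Fin n → ℝ, {v : ℝ | ∃ W : Matrix (Fin c) (Fin d) ℝ,
          rowNormSum W ≤ A ∧ (1 / n : ℝ) * ∑ i, ellTilde ℓ B σ W (x i) (y i) ≤ r ∧
          v = (1 / n : ℝ) * ∑ i, z i * ellTilde ℓ B σ W (x i) (y i)} = ∅ := by
      intro z
      refine Set.eq_empty_of_forall_notMem ?_
      rintro v ⟨W, h1, h2, -⟩
      exact (Set.eq_empty_iff_forall_notMem.1 hF W) ⟨h1, h2⟩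
    simp only [hempty, Real.sSup_empty, Finset.sum_const_zero, zero_div]
    exact hrhs
  set u : Fin n → EuclideanSpace ℝ (Fin d) := fun i => ‖x i‖⁻¹ • x i with hu
  have hu1 : ∀ i, ‖u i‖ ≤ 1 := by
    intro i
    simp only [hu, norm_smul, norm_inv, norm_norm]
    rw [inv_mul_cancel₀ (norm_ne_zero_iff.2 (hx i))]
  set f : Matrix (Fin c) (Fin d) ℝ → Fin n → ℝ :=
    fun W i => ellTilde ℓ B σ W (x i) (y i)
  set Q := Real.sqrt (B * r) with hQ
  have hQ0 : 0 < Q := Real.sqrt_pos.2 (by positivity)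
  have hQ2 : Q ^ 2 = B * r := Real.sq_sqrt (by positivity)
  set N := Real.sqrt n with hN
  have hN0 : 0 < N := Real.sqrt_pos.2 hn'
  have hN2 : N ^ 2 = n := Real.sq_sqrt hn'.le
  set K := 8 * A * Q * N / σ with hK
  have hK0 : 0 < K := by positivity
  have hKsq : ∀ t : ℝ, 4 * n * r * B * (4 * A / t) ^ 2 / σ ^ 2 = (K / t) ^ 2 := by
    intro t
    have : (K / t) ^ 2 = 64 * A ^ 2 * Q ^ 2 * N ^ 2 / σ ^ 2 / t ^ 2 := by rw [hK]; ring
    rw [this, hQ2, hN2]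
    ring
  have hdiam : ∀ a ∈ f '' F, ∀ b ∈ f '' F, ∑ i, (a i - b i) ^ 2 ≤ K ^ 2 := by
    rintro _ ⟨W, hW, rfl⟩ _ ⟨W', hW', rfl⟩
    have h1 := sum_sq_ellTilde_sub_le hn x y ℓ hnonneg hB hσ hW.2 hW'.2 (h := 4 * A / 1)
      fun i => by
        have h2 := norm_rowInner_le (matrixRows W) (hu1 i) hW.1
        have h3 := norm_rowInner_le (matrixRows W') (hu1 i) hW'.1
        have h4 := norm_sub_le (rowInner (matrixRows W) (u i)) (rowInner (matrixRows W') (u i))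
        have h5 : A + A ≤ 4 * A / 1 := by linarith
        exact h4.trans ((add_le_add h2 h3).trans h5)
    rw [hKsq, div_one] at h1
    exact h1
  have hcov : ∀ j : ℕ, ∃ S : Finset (Fin n → ℝ), S.Nonempty ∧ ↑S ⊆ f '' F ∧
      Real.log S.card ≤ 4 ^ j * Λ ∧
      ∀ a ∈ f '' F, ∃ b ∈ S, ∑ i, (a i - b i) ^ 2 ≤ (K / 2 ^ j) ^ 2 := by
    classical
    intro j
    obtain ⟨S, hS, hSF, hcard, hScov⟩ :=
      exists_matrix_cover hn hc u hu1 hA hF (fun W hW => hW.1) j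
    refine ⟨S.image f, hS.image f, ?_, ?_, ?_⟩
    · rw [Finset.coe_image]
      exact Set.image_mono hSF
    · refine (Real.log_le_log ?_ ?_).trans hcard
      · exact_mod_cast (hS.image f).card_pos
      · exact_mod_cast Finset.card_image_le
    · rintro _ ⟨W, hW, rfl⟩
      obtain ⟨W', hW', hd'⟩ := hScov W hW
      refine ⟨f W', Finset.mem_image_of_mem f hW', ?_⟩
      rw [← hKsq]
      exact sum_sq_ellTilde_sub_le hn x y ℓ hnonneg hB hσ hW.2 (hSF hW').2 hd'
  obtain ⟨M, hM, hMβ⟩ := rademacherBound_of_covers (f '' F) hK0 (by linarith : 0 < Λ)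
    hdiam hcov (Nat.log 2 n + 1)
  have hsup : ∀ e : Fin n → Bool, sSup {v : ℝ | ∃ W : Matrix (Fin c) (Fin d) ℝ,
          rowNormSum W ≤ A ∧ (1 / n : ℝ) * ∑ i, ellTilde ℓ B σ W (x i) (y i) ≤ r ∧
          v = (1 / n : ℝ) * ∑ i, boolSign (e i) * ellTilde ℓ B σ W (x i) (y i)} ≤
        (1 / n : ℝ) * M e := by
    intro e
    obtain ⟨W₀, hW₀⟩ := hF
    refine csSup_le ⟨_, W₀, hW₀.1, hW₀.2, rfl⟩ ?_
    rintro v ⟨W, h1, h2, rfl⟩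
    exact mul_le_mul_of_nonneg_left (hM e (f W) ⟨W, ⟨h1, h2⟩, rfl⟩) (by positivity)
  refine (div_le_div_of_nonneg_right (Finset.sum_le_sum fun e _ => hsup e)
    (by positivity)).trans ?_
  rw [← Finset.mul_sum, mul_div_assoc]
  refine (mul_le_mul_of_nonneg_left hMβ (by positivity)).trans ?_
  set q := Real.sqrt Λ with hq
  have hq0 : 0 ≤ q := Real.sqrt_nonneg _
  have hq2 : q ^ 2 = Λ := Real.sq_sqrt (by linarith)
  have hq1 : 1 ≤ q := Real.one_le_sqrt.2 (by linarith)
  have h2q : Real.sqrt (2 * Λ) ≤ 2 * q := by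
    rw [Real.sqrt_le_left (by positivity), mul_pow, hq2]
    linarith
  have hroot : Real.sqrt (B * r * Λ ^ 3) = Q * (Λ * q) := by
    rw [Real.sqrt_mul (by positivity) (Λ ^ 3), pow_succ Λ 2,
      Real.sqrt_mul (by positivity) Λ, Real.sqrt_sq (by linarith)]
  have hlevels := natLog_add_two_le hn hc
  rw [← hΛ] at hlevels
  have hres : N * (K / 2 ^ (Nat.log 2 n + 1)) ≤ K := by
    have h1 : (n : ℝ) ≤ 2 ^ (Nat.log 2 n + 1) := by
      exact_mod_cast (Nat.lt_pow_succ_log_self one_lt_two n).le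
    have h2 : N ≤ n := by
      rw [hN, Real.sqrt_le_left hn'.le]
      have : (1 : ℝ) ≤ n := by exact_mod_cast hn
      nlinarith
    rw [← mul_div_assoc, div_le_iff₀ (by positivity), mul_comm]
    gcongr
    linarith
  have hmain : (((Nat.log 2 n + 1 : ℕ) : ℝ) + 1) * (2 * K * Real.sqrt (2 * Λ)) ≤
      8 * K * (Λ * q) := by
    calc (((Nat.log 2 n + 1 : ℕ) : ℝ) + 1) * (2 * K * Real.sqrt (2 * Λ))
        ≤ (2 * Λ) * (2 * K * (2 * q)) := by
          gcongr
          push_cast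
          linarith
      _ = _ := by ring
  have hΛq : 1 ≤ Λ * q := by nlinarith
  have hKq : K ≤ K * (Λ * q) := le_mul_of_one_le_right hK0.le hΛq
  calc (1 / n : ℝ) * ((((Nat.log 2 n + 1 : ℕ) : ℝ) + 1) * (2 * K * Real.sqrt (2 * Λ)) +
        N * (K / 2 ^ (Nat.log 2 n + 1)))
      ≤ (1 / n : ℝ) * (9 * K * (Λ * q)) := by
        gcongr
        linarith
    _ = 72 * A * (Q * (Λ * q)) / (σ * N) := by
        rw [hK, ← hN2]
        field_simp
        ring
    _ ≤ 3500 * A * (Q * (Λ * q)) / (σ * N) := by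
        gcongr
        norm_num
    _ = _ := by rw [hroot]
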